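/- For all real P ≥ 2, all R with 2 ≤ R ≤ P, and all nonzero integers a, b, c, d, one has I(a,b,c,d) ≤ Σ_{n∈ℤ} |ψ(n)|³. -/

import Mathlib

open scoped Real
open Filter MeasureTheory

noncomputable section

/-- `e(z) = exp(2πiz)`. -/
def e (z : ℝ) : ℂ := Complex.exp (2 * Real.pi * Complex.I * z)

/-- The set `𝒜(P,R)` of `R`-smooth positive integers not exceeding `P`. -/
def smoothA (P R : ℝ) : Finset ℕ :=
  (Finset.Icc 1 ⌊P⌋₊).filter (fun n => ∀ p ∈ n.primeFactors, (p : ℝ) ≤ R)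

/-- The smooth Weyl sum `h(α; P, R)`. -/
def h (P R α : ℝ) : ℂ := ∑ x ∈ smoothA P R, e (α * (x : ℝ) ^ 4)

/-- `Δ₇ = 0.849408`. -/
def Δ₇ : ℝ := 0.849408

/-- `Δ₁₀ = 0.213431`. -/
def Δ₁₀ : ℝ := 0.213431

/-- The Fourier coefficient `ψ(n) = ∫₀¹ |h(α)|⁷ e(-nα) dα`. -/
def ψ (P R : ℝ) (n : ℤ) : ℂ :=
  ∫ α in (0:ℝ)..1, (‖h P R α‖ : ℂ) ^ 7 * e (-(n : ℝ) * α)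

/-- The correlation integral `I(a,b,c,d) = ∫₀¹∫₀¹ |h(aα)h(bβ)h(cα+dβ)|⁷ dα dβ`. -/
def Icorr (P R : ℝ) (a b c d : ℤ) : ℝ :=
  ∫ α in (0:ℝ)..1, ∫ β in (0:ℝ)..1,
    ‖h P R ((a : ℝ) * α) * h P R ((b : ℝ) * β) * h P R ((c : ℝ) * α + (d : ℝ) * β)‖ ^ 7

theorem e_zero : e 0 = 1 := by simp [e]

theorem e_add (x y : ℝ) : e (x + y) = e x * e y := by
  rw [e, e, e, ← Complex.exp_add]; push_cast; ring_nf

theorem e_int (n : ℤ) : e n = 1 := by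
  rw [e, Complex.exp_eq_one_iff]
  exact ⟨n, by push_cast; ring⟩

theorem norm_e (x : ℝ) : ‖e x‖ = 1 := by
  rw [e, show (2 * Real.pi * Complex.I * x : ℂ) = ((2 * Real.pi * x : ℝ) : ℂ) * Complex.I by
    push_cast; ring, Complex.norm_exp_ofReal_mul_I]

@[fun_prop]
theorem contDiff_e {n : WithTop ℕ∞} : ContDiff ℝ n e := by
  unfold e
  exact (contDiff_const.mul Complex.ofRealCLM.contDiff).cexp

@[fun_prop]
theorem continuous_e : Continuous e := contDiff_e (n := 0) |>.continuous

theorem hasDerivAt_e_const_mul (m x : ℝ) :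
    HasDerivAt (fun x : ℝ => e (m * x)) (2 * Real.pi * Complex.I * m * e (m * x)) x := by
  unfold e
  have h1 : HasDerivAt (fun x : ℝ => ((m * x : ℝ) : ℂ)) (m : ℂ) x := by
    simpa using ((hasDerivAt_id x).const_mul m).ofReal_comp
  have := (h1.const_mul (2 * Real.pi * Complex.I)).cexp
  convert this using 1
  ring

/-- Orthogonality of the characters `x ↦ e (k x)` on `[0, 1]`. -/
theorem integral_e_int_mul (k : ℤ) :
    ∫ x in (0 : ℝ)..1, e (k * x) = if k = 0 then 1 else 0 := by
  split_ifs with hk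
  · simp [hk, e_zero]
  · have hc : (2 * Real.pi * Complex.I * (k : ℝ) : ℂ) ≠ 0 := by
      simp [hk, Real.pi_ne_zero]
    have key := intervalIntegral.integral_eq_sub_of_hasDerivAt
      (fun x _ => hasDerivAt_e_const_mul (k : ℝ) x)
      ((by fun_prop : Continuous fun x : ℝ =>
        2 * Real.pi * Complex.I * ((k : ℝ) : ℂ) * e (k * x)).intervalIntegrable 0 1)
    rw [intervalIntegral.integral_const_mul] at key
    simp only [mul_one, mul_zero, e_int, e_zero, sub_self, mul_eq_zero] at key
    exact key.resolve_left (by simpa using hc)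

/-- The `n`-th Fourier coefficient of a function of period `1`. -/
def unitCoeff (f : ℝ → ℂ) (n : ℤ) : ℂ := ∫ x in (0 : ℝ)..1, f x * e (-(n : ℝ) * x)

theorem norm_unitCoeff_le (f : ℝ → ℂ) {C : ℝ} (hC : ∀ x ∈ Set.Icc (0 : ℝ) 1, ‖f x‖ ≤ C) (n : ℤ) :
    ‖unitCoeff f n‖ ≤ C := by
  have := intervalIntegral.norm_integral_le_of_norm_le_const (a := (0 : ℝ)) (b := 1) (C := C)
    (f := fun x => f x * e (-(n : ℝ) * x)) (by
      intro x hx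
      rw [Set.uIoc_of_le zero_le_one] at hx
      rw [norm_mul, norm_e, mul_one]
      exact hC x (Set.Ioc_subset_Icc_self hx))
  simpa [unitCoeff] using this

theorem periodic_deriv {f : ℝ → ℂ} {c : ℝ} (hp : f.Periodic c) : (deriv f).Periodic c := by
  intro x
  rw [← deriv_comp_add_const]
  exact congrArg (fun g => deriv g x) (funext hp)

theorem unitCoeff_deriv {f : ℝ → ℂ} (hf : ContDiff ℝ 1 f) (hp : f.Periodic 1) (n : ℤ) :
    unitCoeff (deriv f) n = 2 * Real.pi * Complex.I * n * unitCoeff f n := by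
  have hcont := hf.continuous_deriv le_rfl
  have := intervalIntegral.integral_mul_deriv_eq_deriv_mul (a := (0 : ℝ)) (b := 1)
    (u := fun x => e (-(n : ℝ) * x)) (v := f)
    (u' := fun x => 2 * Real.pi * Complex.I * ((-(n : ℝ) : ℝ) : ℂ) * e (-(n : ℝ) * x))
    (v' := deriv f) (fun x _ => hasDerivAt_e_const_mul _ x)
    (fun x _ => (hf.differentiable one_ne_zero x).hasDerivAt)
    ((by fun_prop : Continuous _).intervalIntegrable 0 1) (hcont.intervalIntegrable 0 1)
  have h01 : f 1 = f 0 := by simpa using hp 0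
  have he : e (-(n : ℝ)) = 1 := by simpa using e_int (-n)
  simp only [mul_one, mul_zero, e_zero, he, h01, sub_self, zero_sub] at this
  unfold unitCoeff
  simp_rw [mul_comm _ (e _)]
  rw [this, ← intervalIntegral.integral_const_mul, ← intervalIntegral.integral_neg]
  congr 1
  ext x
  push_cast
  ring

theorem summable_norm_unitCoeff {f : ℝ → ℂ} (hf : ContDiff ℝ 2 f) (hp : f.Periodic 1) :
    Summable fun n => ‖unitCoeff f n‖ := by
  have hf' : ContDiff ℝ 1 (deriv f) := ContDiff.deriv' hf
  obtain ⟨C, hC⟩ := isCompact_Icc.exists_bound_of_continuousOn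
    (hf'.continuous_deriv le_rfl).continuousOn (s := Set.Icc (0 : ℝ) 1)
  have hs : Summable fun n : ℤ => C * (1 / (n : ℝ) ^ 2) :=
    (Real.summable_one_div_int_pow.2 one_lt_two).mul_left C
  refine hs.of_norm_bounded_eventually ?_
  filter_upwards [(Set.finite_singleton (0 : ℤ)).compl_mem_cofinite] with n hn
  have hn0 : (n : ℝ) ≠ 0 := by simpa using hn
  have h2 := norm_unitCoeff_le (deriv (deriv f)) hC n
  rw [unitCoeff_deriv hf' (periodic_deriv hp), unitCoeff_deriv (hf.of_le one_le_two) hp] at h2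
  have hpi : ‖(2 * Real.pi * Complex.I * n : ℂ)‖ = 2 * Real.pi * |(n : ℝ)| := by
    simp [abs_of_pos Real.pi_pos]
  rw [← mul_assoc, norm_mul, norm_mul, hpi] at h2
  rw [norm_norm, mul_one_div, le_div_iff₀ (by positivity)]
  refine le_trans ?_ h2
  rw [show 2 * π * |(n : ℝ)| * (2 * π * |(n : ℝ)|) = (2 * π) ^ 2 * (n : ℝ) ^ 2 by
    rw [← sq_abs (n : ℝ)]; ring, mul_comm]
  have : 1 ≤ (2 * π) ^ 2 := by nlinarith [Real.pi_gt_three]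
  gcongr
  exact le_mul_of_one_le_left (by positivity) this

theorem hasSum_unitCoeff_mul_e {f : ℝ → ℂ} (hf : ContDiff ℝ 2 f) (hp : f.Periodic 1) (x : ℝ) :
    HasSum (fun n => unitCoeff f n * e (n * x)) (f x) := by
  let g : C(AddCircle (1 : ℝ), ℂ) := ⟨hp.lift, continuous_coinduced_dom.2 hf.continuous⟩
  have hg (n : ℤ) : fourierCoeff g n = unitCoeff f n := by
    rw [fourierCoeff_eq_intervalIntegral g n 0, unitCoeff]
    simp only [div_one, one_smul, zero_add, smul_eq_mul]
    congr 1
    ext x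
    rw [fourier_coe_apply, mul_comm, e]
    congr 2
    push_cast
    ring
  have hs : Summable (fourierCoeff g) := by
    rw [funext hg]
    exact (summable_norm_unitCoeff hf hp).of_norm
  have := has_pointwise_sum_fourier_series_of_summable hs (x : AddCircle (1 : ℝ))
  rw [show g (x : AddCircle (1 : ℝ)) = f x from rfl] at this
  convert this using 2 with n
  rw [hg, smul_eq_mul, fourier_coe_apply, e]
  congr 2
  push_cast
  ring

/-- Termwise integration of an absolutely convergent series of characters against `g`. -/
theorem hasSum_mul_integral_e {w : ℤ → ℂ} (hw : Summable fun n => ‖w n‖) {g F : ℝ → ℂ}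
    {u : ℝ → ℝ} (hg : Continuous g) (hu : Continuous u)
    (hF : ∀ x, HasSum (fun n : ℤ => w n * e (n * u x)) (F x)) :
    HasSum (fun n : ℤ => w n * ∫ x in (0 : ℝ)..1, g x * e (n * u x))
      (∫ x in (0 : ℝ)..1, g x * F x) := by
  simp_rw [← intervalIntegral.integral_const_mul]
  refine intervalIntegral.hasSum_integral_of_dominated_convergence
    (fun n x => ‖w n‖ * ‖g x‖) (fun n => ?_) (fun n => ?_) ?_ ?_ ?_
  · exact (by fun_prop : Continuous _).aestronglyMeasurable
  · exact .of_forall fun x _ => by simp [norm_e]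
  · exact .of_forall fun x _ => hw.mul_right _
  · simp_rw [tsum_mul_right]
    exact (by fun_prop : Continuous _).intervalIntegrable 0 1
  · refine .of_forall fun x _ => ?_
    simpa only [mul_left_comm] using (hF x).mul_left (g x)

theorem hasSum_unitCoeff_comp_mul {f : ℝ → ℂ} (hf : ContDiff ℝ 2 f) (hp : f.Periodic 1)
    (a m : ℤ) :
    HasSum (fun k => unitCoeff f k * if k * a = m then 1 else 0)
      (unitCoeff (fun x => f (a * x)) m) := by
  have := hasSum_mul_integral_e (summable_norm_unitCoeff hf hp)
    (g := fun x => e (-(m : ℝ) * x)) (u := fun x => a * x) (by fun_prop) (by fun_prop)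
    (fun x => hasSum_unitCoeff_mul_e hf hp (a * x))
  convert this using 2 with k
  · have hk : (k * a = m) = (k * a - m = 0) := by rw [sub_eq_zero]
    simp only [hk]
    rw [← integral_e_int_mul (k * a - m)]
    congr 2
    ext x
    rw [← e_add]
    congr 1
    push_cast
    ring
  · simp_rw [unitCoeff, mul_comm]

theorem unitCoeff_comp_mul_of_eq {f : ℝ → ℂ} (hf : ContDiff ℝ 2 f) (hp : f.Periodic 1)
    {a m k : ℤ} (ha : a ≠ 0) (hk : m = a * k) :
    unitCoeff (fun x => f (a * x)) m = unitCoeff f k := by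
  refine (hasSum_unitCoeff_comp_mul hf hp a m).unique ?_
  convert hasSum_single k ?_ using 1
  · simp [hk, mul_comm]
  · intro j hj
    rw [if_neg, mul_zero]
    rw [hk, mul_comm a]
    exact fun h => hj (mul_right_cancel₀ ha h)

theorem unitCoeff_comp_mul_of_not_dvd {f : ℝ → ℂ} (hf : ContDiff ℝ 2 f) (hp : f.Periodic 1)
    {a m : ℤ} (hm : ¬ a ∣ m) : unitCoeff (fun x => f (a * x)) m = 0 := by
  refine (hasSum_unitCoeff_comp_mul hf hp a m).unique ?_
  convert hasSum_zero with k
  rw [if_neg, mul_zero]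
  rintro rfl
  exact hm (dvd_mul_left _ _)

theorem summable_norm_unitCoeff_pow_three {f : ℝ → ℂ} (hf : ContDiff ℝ 2 f) (hp : f.Periodic 1) :
    Summable fun n => ‖unitCoeff f n‖ ^ 3 := by
  have hs := summable_norm_unitCoeff hf hp
  refine hs.of_norm_bounded_eventually ?_
  filter_upwards [hs.tendsto_cofinite_zero.eventually_le_const zero_lt_one] with n hn
  rw [norm_pow, norm_norm]
  exact pow_le_of_le_one (norm_nonneg _) hn three_ne_zero

/-- The Fourier coefficients of a dilate, sampled along a nonzero multiple, have no larger cubic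
moment than those of the function itself. -/
theorem tsum_unitCoeff_comp_mul_pow_three_le {f : ℝ → ℂ} (hf : ContDiff ℝ 2 f)
    (hp : f.Periodic 1) {a c : ℤ} (ha : a ≠ 0) (hc : c ≠ 0) :
    (Summable fun n : ℤ => ‖unitCoeff (fun x => f (a * x)) (c * n)‖ ^ 3) ∧
      ∑' n : ℤ, ‖unitCoeff (fun x => f (a * x)) (c * n)‖ ^ 3 ≤ ∑' n, ‖unitCoeff f n‖ ^ 3 := by
  let S := {n : ℤ // a ∣ c * n}
  choose j hj using fun s : S => s.2
  have hinj : Function.Injective j := fun s t hst =>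
    Subtype.ext (mul_left_cancel₀ hc (by rw [hj s, hj t, hst]))
  have hval (s : S) : ‖unitCoeff (fun x => f (a * x)) (c * s.1)‖ ^ 3 = ‖unitCoeff f (j s)‖ ^ 3 := by
    rw [unitCoeff_comp_mul_of_eq hf hp ha (hj s)]
  have hzero (n : ℤ) (hn : ¬ a ∣ c * n) : ‖unitCoeff (fun x => f (a * x)) (c * n)‖ ^ 3 = 0 := by
    simp [unitCoeff_comp_mul_of_not_dvd hf hp hn]
  have hs3 := summable_norm_unitCoeff_pow_three hf hp
  constructor
  · refine (Subtype.val_injective (p := fun n : ℤ => a ∣ c * n)).summable_iff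
      (fun n hn => hzero n (by simpa using hn)) |>.1 ?_
    exact (hs3.comp_injective hinj).congr fun s => (hval s).symm
  · rw [← (Subtype.val_injective (p := fun n : ℤ => a ∣ c * n)).tsum_eq (fun n hn => by
      by_contra h
      exact hn (hzero n (by simpa using h))), tsum_congr hval]
    exact tsum_comp_le_tsum_of_inj hs3 (fun n => by positivity) hinj

theorem mul_mul_le_sum_pow_three {x y z : ℝ} (hx : 0 ≤ x) (hy : 0 ≤ y) (hz : 0 ≤ z) :
    x * (y * z) ≤ (x ^ 3 + y ^ 3 + z ^ 3) / 3 := by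
  nlinarith [mul_nonneg (add_nonneg (add_nonneg hx hy) hz)
    (add_nonneg (add_nonneg (sq_nonneg (x - y)) (sq_nonneg (y - z))) (sq_nonneg (z - x)))]

theorem norm_correlation_le {f : ℝ → ℂ} (hf : ContDiff ℝ 2 f) (hp : f.Periodic 1)
    {a b c d : ℤ} (ha : a ≠ 0) (hb : b ≠ 0) (hc : c ≠ 0) (hd : d ≠ 0) :
    ‖∫ α in (0 : ℝ)..1, ∫ β in (0 : ℝ)..1, f (a * α) * f (b * β) * f (c * α + d * β)‖ ≤
      ∑' n, ‖unitCoeff f n‖ ^ 3 := by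
  have hfc := hf.continuous
  have hs := summable_norm_unitCoeff hf hp
  have hs3 := summable_norm_unitCoeff_pow_three hf hp
  set A : ℤ → ℂ := fun n => unitCoeff (fun x => f (a * x)) (-c * n)
  set B : ℤ → ℂ := fun n => unitCoeff (fun x => f (b * x)) (-d * n)
  obtain ⟨hAs, hAle⟩ := tsum_unitCoeff_comp_mul_pow_three_le hf hp ha (neg_ne_zero.2 hc)
  obtain ⟨hBs, hBle⟩ := tsum_unitCoeff_comp_mul_pow_three_le hf hp hb (neg_ne_zero.2 hd)
  have inner (α : ℝ) : HasSum (fun n : ℤ => unitCoeff f n * B n * e (n * (c * α)))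
      (∫ β in (0 : ℝ)..1, f (b * β) * f (c * α + d * β)) := by
    have := hasSum_mul_integral_e hs (g := fun β => f (b * β)) (u := fun β => c * α + d * β)
      (by fun_prop) (by fun_prop) (fun β => hasSum_unitCoeff_mul_e hf hp (c * α + d * β))
    convert this using 2 with n
    have hBn : B n = ∫ β in (0 : ℝ)..1, f (b * β) * e (-((-d * n : ℤ) : ℝ) * β) := rfl
    rw [mul_assoc, hBn, ← intervalIntegral.integral_mul_const]
    congr 1
    refine intervalIntegral.integral_congr fun β _ => ?_
    rw [mul_assoc, ← e_add]
    congr 2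
    push_cast
    ring
  have hBsum : Summable fun n => ‖unitCoeff f n * B n‖ := by
    obtain ⟨C, hC⟩ := isCompact_Icc.exists_bound_of_continuousOn (s := Set.Icc (0 : ℝ) 1)
      (by fun_prop : Continuous fun x : ℝ => f (b * x)).continuousOn
    refine (hs.mul_right C).of_nonneg_of_le (fun n => norm_nonneg _) fun n => ?_
    rw [norm_mul]
    gcongr
    exact norm_unitCoeff_le _ hC _
  have outer : HasSum (fun n : ℤ => unitCoeff f n * B n * A n)
      (∫ α in (0 : ℝ)..1, ∫ β in (0 : ℝ)..1, f (a * α) * f (b * β) * f (c * α + d * β)) := by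
    have := hasSum_mul_integral_e hBsum (g := fun α => f (a * α)) (u := fun α => c * α)
      (by fun_prop) (by fun_prop) inner
    simp_rw [mul_assoc (f (a * _)), intervalIntegral.integral_const_mul]
    convert this using 2 with n
    have hAn : A n = ∫ α in (0 : ℝ)..1, f (a * α) * e (-((-c * n : ℤ) : ℝ) * α) := rfl
    rw [hAn]
    congr 1
    refine intervalIntegral.integral_congr fun α _ => ?_
    congr 2
    push_cast
    ring
  have hmaj : Summable fun n => (‖unitCoeff f n‖ ^ 3 + ‖B n‖ ^ 3 + ‖A n‖ ^ 3) / 3 :=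
    ((hs3.add hBs).add hAs).div_const 3
  have hterm (n : ℤ) : ‖unitCoeff f n * B n * A n‖ ≤
      (‖unitCoeff f n‖ ^ 3 + ‖B n‖ ^ 3 + ‖A n‖ ^ 3) / 3 := by
    rw [norm_mul, norm_mul, mul_assoc]
    exact mul_mul_le_sum_pow_three (norm_nonneg _) (norm_nonneg _) (norm_nonneg _)
  rw [← outer.tsum_eq]
  refine (tsum_of_norm_bounded hmaj.hasSum hterm).trans ?_
  rw [tsum_div_const, (hs3.add hBs).tsum_add hAs, hs3.tsum_add hBs]
  linarith

theorem contDiff_h (P R : ℝ) : ContDiff ℝ 2 (h P R) := by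
  unfold h
  fun_prop

theorem periodic_h (P R : ℝ) : (h P R).Periodic 1 := by
  intro x
  refine Finset.sum_congr rfl fun n _ => ?_
  have := e_int ((n : ℤ) ^ 4)
  push_cast at this
  rw [add_mul, one_mul, e_add, this, mul_one]

theorem contDiff_norm_h_pow (P R : ℝ) : ContDiff ℝ 2 fun x => (‖h P R x‖ : ℂ) ^ 7 := by
  have h1 : ContDiff ℝ 2 fun x => (‖h P R x‖ ^ 2) ^ (7 / 2 : ℝ) :=
    ((contDiff_h P R).norm_sq ℝ).rpow_const_of_le (m := 2) (by norm_num)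
  convert Complex.ofRealCLM.contDiff.comp h1 using 2 with x
  rw [Function.comp_apply, Complex.ofRealCLM_apply, ← Real.rpow_natCast_mul (norm_nonneg _)]
  norm_num

/-- for all `P ≥ 2`, `2 ≤ R ≤ P` and all nonzero integers `a, b, c, d`,
one has `I(a,b,c,d) ≤ Σ_{n∈ℤ} |ψ(n)|³`. -/
theorem correlation_le_cubic_moment (P R : ℝ) (hP : 2 ≤ P) (hR : 2 ≤ R) (hRP : R ≤ P)
    (a b c d : ℤ) (ha : a ≠ 0) (hb : b ≠ 0) (hc : c ≠ 0) (hd : d ≠ 0) :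
    Icorr P R a b c d ≤ ∑' n : ℤ, ‖ψ P R n‖ ^ 3 := by
  have key := norm_correlation_le (contDiff_norm_h_pow P R)
    (fun x => by simp only [periodic_h P R x]) ha hb hc hd
  refine le_trans ?_ key
  refine (le_abs_self _).trans (le_of_eq ?_)
  rw [← Real.norm_eq_abs, ← Complex.norm_real, Icorr]
  simp_rw [← intervalIntegral.integral_ofReal]
  simp [mul_pow]
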